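/- Let V : ℝ² → [0,∞) be locally integrable. Define annuli U_0 := { x : e^{−1} < |x| < e }, U_n := { x : e^{2^{n−1}} < |x| < e^{2^n} } for n > 0, U_n := { x : e^{−2^{|n|}} < |x| < e^{−2^{|n|−1}} } for n < 0, and set A_0 := ∫_{U_0} V(x) dx, A_n := ∫_{U_n} V(x)·|log|x|| dx for n ≠ 0. If N ∈ ℕ and card{ n ∈ ℤ : A_n ≥ 10π } ≥ 3N, then there exist functions w_1, …, w_N : ℝ² → ℝ, each Lipschitz continuous, compactly supported, not identically zero, with pairwise disjoint supports, such that for each j: ∫_{ℝ²} ‖(∇w_j)(x)‖² dx < ∫_{ℝ²} V(x)·w_j(x)² dx, where ∇w_j denotes the (almost everywhere defined) total derivative of w_j and the left integral is taken over the set where w_j is differentiable. -/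

import Mathlib

open MeasureTheory ENNReal

/-- The annuli `U_n` of (5.17): `U_0 = {e⁻¹ < |x| < e}`,
`U_n = {e^{2^{n−1}} < |x| < e^{2^n}}` for `n > 0`, and
`U_n = {e^{−2^{|n|}} < |x| < e^{−2^{|n|−1}}}` for `n < 0`. -/
noncomputable def annU (n : ℤ) : Set (EuclideanSpace ℝ (Fin 2)) :=
  if 0 < n then {x | Real.exp ((2 : ℝ) ^ (n - 1)) < ‖x‖ ∧ ‖x‖ < Real.exp ((2 : ℝ) ^ n)}
  else if n < 0 then
    {x | Real.exp (-(2 : ℝ) ^ (-n)) < ‖x‖ ∧ ‖x‖ < Real.exp (-(2 : ℝ) ^ (-n - 1))}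
  else {x | Real.exp (-1) < ‖x‖ ∧ ‖x‖ < Real.exp 1}

/-- The quantities `A_n` of (5.18): `A_0 = ∫_{U_0} V dx` and
`A_n = ∫_{U_n} V(x)·|log|x|| dx` for `n ≠ 0`. -/
noncomputable def annA (V : EuclideanSpace ℝ (Fin 2) → ℝ) (n : ℤ) : ℝ≥0∞ :=
  if n = 0 then ∫⁻ x in annU 0, ENNReal.ofReal (V x)
  else ∫⁻ x in annU n, ENNReal.ofReal (V x * |Real.log ‖x‖|)


abbrev E2 := EuclideanSpace ℝ (Fin 2)

lemma ann_energy (a b s : ℝ) (hab : a < b) :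
    ∫⁻ x : E2, ENNReal.ofReal ((Set.Ioc (Real.exp a) (Real.exp b)).indicator
      (fun r => (s * r⁻¹) ^ 2) ‖x‖) = ENNReal.ofReal (2 * Real.pi * s ^ 2 * (b - a)) := by
  set f : ℝ → ℝ := (Set.Ioc (Real.exp a) (Real.exp b)).indicator (fun r => (s * r⁻¹) ^ 2) with hf
  have hle : Real.exp a ≤ Real.exp b := Real.exp_le_exp.2 hab.le
  have hsub : Set.Ioc (Real.exp a) (Real.exp b) ⊆ Set.Ioi 0 := fun x hx =>
    lt_trans (Real.exp_pos a) hx.1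
  have hdim : Module.finrank ℝ E2 - 1 = 1 := by simp
  have h1 : ∀ y : ℝ, y ∈ Set.Ioi (0:ℝ) → y ^ (Module.finrank ℝ E2 - 1) • f y =
      (Set.Ioc (Real.exp a) (Real.exp b)).indicator (fun r => s ^ 2 * r⁻¹) y := by
    intro y hy
    have hy : 0 < y := hy
    rw [hdim]
    by_cases h : y ∈ Set.Ioc (Real.exp a) (Real.exp b)
    · simp only [hf, Set.indicator_of_mem h, smul_eq_mul]; field_simp
    · simp [hf, Set.indicator_of_notMem h]
  have hii : IntervalIntegrable (fun r : ℝ => s ^ 2 * r⁻¹) volume (Real.exp a) (Real.exp b) := by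
    apply IntervalIntegrable.const_mul
    apply intervalIntegral.intervalIntegrable_inv
    · intro x hx
      rw [Set.uIcc_of_le hle] at hx
      exact (lt_of_lt_of_le (Real.exp_pos a) hx.1).ne'
    · exact continuousOn_id
  have hint : IntegrableOn (fun y : ℝ => y ^ (Module.finrank ℝ E2 - 1) • f y) (Set.Ioi 0) := by
    rw [integrableOn_congr_fun h1 measurableSet_Ioi]
    rw [intervalIntegrable_iff_integrableOn_Ioc_of_le hle] at hii
    exact ((integrable_indicator_iff measurableSet_Ioc).2 hii).integrableOn
  rw [← ofReal_integral_eq_lintegral_ofReal]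
  · congr 1
    rw [integral_fun_norm_addHaar volume f, setIntegral_congr_fun measurableSet_Ioi h1,
      setIntegral_indicator measurableSet_Ioc, Set.inter_eq_right.2 hsub,
      ← intervalIntegral.integral_of_le hle, intervalIntegral.integral_const_mul,
      integral_inv_of_pos (Real.exp_pos _) (Real.exp_pos _), ← Real.exp_sub, Real.log_exp]
    simp [Measure.real, EuclideanSpace.volume_ball_fin_two, ENNReal.toReal_ofReal Real.pi_pos.le]
    ring
  · exact (integrable_fun_norm_addHaar volume).2 hint
  · refine Filter.Eventually.of_forall fun x => ?_
    exact Set.indicator_nonneg (fun _ _ => sq_nonneg _) _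

noncomputable def tent (a b c d : ℝ) (x : E2) : ℝ :=
  max 0 (min 1 (min ((Real.log (max ‖x‖ (Real.exp a)) - a) / (b - a))
    ((d - Real.log (max ‖x‖ (Real.exp a))) / (d - c))))

lemma logmax {a : ℝ} {x : E2} (h : Real.exp a ≤ ‖x‖) :
    Real.log (max ‖x‖ (Real.exp a)) = Real.log ‖x‖ := by rw [max_eq_left h]

lemma tent_lip (a b c d : ℝ) (hab : a < b) (hcd : c < d) :
    ∃ K : NNReal, LipschitzWith K (tent a b c d) := by
  have hlog : ∃ K : NNReal, LipschitzWith K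
      (fun x : E2 => Real.log (max ‖x‖ (Real.exp a))) := by
    refine ⟨(Real.exp (-a)).toNNReal, LipschitzWith.of_dist_le_mul fun x y => ?_⟩
    rw [Real.coe_toNNReal _ (Real.exp_pos _).le]
    have key : ∀ u v : ℝ, Real.exp a ≤ u → Real.exp a ≤ v → u ≤ v →
        Real.log v - Real.log u ≤ Real.exp (-a) * (v - u) := by
      intro u v hu hv huv
      have hu0 := lt_of_lt_of_le (Real.exp_pos a) hu
      have hv0 := lt_of_lt_of_le (Real.exp_pos a) hv
      rw [← Real.log_div hv0.ne' hu0.ne']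
      refine (Real.log_le_sub_one_of_pos (div_pos hv0 hu0)).trans ?_
      rw [Real.exp_neg]
      have : v / u - 1 = u⁻¹ * (v - u) := by field_simp
      rw [this]
      exact mul_le_mul_of_nonneg_right (inv_anti₀ (Real.exp_pos a) hu) (by linarith)
    have hm : |max ‖x‖ (Real.exp a) - max ‖y‖ (Real.exp a)| ≤ dist x y :=
      (abs_max_sub_max_le_abs _ _ _).trans (by
        rw [dist_eq_norm]; exact abs_norm_sub_norm_le x y)
    refine le_trans ?_ (mul_le_mul_of_nonneg_left hm (Real.exp_pos _).le)
    rw [Real.dist_eq]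
    rcases le_total (max ‖x‖ (Real.exp a)) (max ‖y‖ (Real.exp a)) with h | h
    · rw [abs_sub_comm, abs_sub_comm (max ‖x‖ _), abs_of_nonneg (sub_nonneg.2 h), abs_of_nonneg]
      · exact key _ _ (le_max_right _ _) (le_max_right _ _) h
      · exact sub_nonneg.2 (Real.log_le_log (lt_of_lt_of_le (Real.exp_pos a) (le_max_right _ _)) h)
    · rw [abs_of_nonneg (sub_nonneg.2 h), abs_of_nonneg]
      · exact key _ _ (le_max_right _ _) (le_max_right _ _) h
      · exact sub_nonneg.2 (Real.log_le_log (lt_of_lt_of_le (Real.exp_pos a) (le_max_right _ _)) h)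
  obtain ⟨K, hK⟩ := hlog
  have h1 : ∃ K1 : NNReal, LipschitzWith K1 (fun t : ℝ => (t - a) / (b - a)) := by
    refine ⟨((b - a)⁻¹).toNNReal, LipschitzWith.of_dist_le_mul fun x y => ?_⟩
    have : 0 < b - a := by linarith
    rw [Real.coe_toNNReal _ (by positivity), Real.dist_eq, Real.dist_eq, ← sub_div, abs_div,
      abs_of_pos this]
    apply le_of_eq; rw [sub_sub_sub_cancel_right]; ring
  have h2 : ∃ K1 : NNReal, LipschitzWith K1 (fun t : ℝ => (d - t) / (d - c)) := by
    refine ⟨((d - c)⁻¹).toNNReal, LipschitzWith.of_dist_le_mul fun x y => ?_⟩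
    have : 0 < d - c := by linarith
    rw [Real.coe_toNNReal _ (by positivity), Real.dist_eq, Real.dist_eq, ← sub_div, abs_div,
      abs_of_pos this]
    apply le_of_eq; rw [abs_sub_comm x y, show d - x - (d - y) = y - x by ring]; ring
  obtain ⟨K1, h1⟩ := h1
  obtain ⟨K2, h2⟩ := h2
  exact ⟨_, (((h1.comp hK).min (h2.comp hK)).const_min 1).const_max 0⟩

lemma tent_supp (a b c d : ℝ) (hab : a < b) (hcd : c < d) (had : a < d) (x : E2)
    (hx : tent a b c d x ≠ 0) : Real.exp a < ‖x‖ ∧ ‖x‖ < Real.exp d := by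
  have hba : 0 < b - a := by linarith
  have hdc : 0 < d - c := by linarith
  by_contra hcon
  apply hx
  rw [not_and_or, not_lt, not_lt] at hcon
  unfold tent
  apply max_eq_left
  refine (min_le_right _ _).trans ?_
  rcases hcon with h | h
  · refine (min_le_left _ _).trans ?_
    rw [max_eq_right h, Real.log_exp]; simp
  · refine (min_le_right _ _).trans ?_
    have h' : Real.exp a ≤ ‖x‖ := (Real.exp_lt_exp.2 had).le.trans h
    rw [logmax h']
    have : d ≤ Real.log ‖x‖ := (Real.le_log_iff_exp_le ((Real.exp_pos d).trans_le h)).2 h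
    exact div_nonpos_of_nonpos_of_nonneg (by linarith) hdc.le

lemma tent_one (a b c d : ℝ) (hab : a < b) (hcd : c < d) (x : E2)
    (h1 : Real.exp b ≤ ‖x‖) (h2 : ‖x‖ ≤ Real.exp c) : tent a b c d x = 1 := by
  have hba : 0 < b - a := by linarith
  have hdc : 0 < d - c := by linarith
  have h0 : 0 < ‖x‖ := (Real.exp_pos b).trans_le h1
  have h3 : b ≤ Real.log ‖x‖ := (Real.le_log_iff_exp_le h0).2 h1
  have h4 : Real.log ‖x‖ ≤ c := (Real.log_le_iff_le_exp h0).2 h2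
  unfold tent
  rw [logmax ((Real.exp_lt_exp.2 hab).le.trans h1), min_eq_left, max_eq_right zero_le_one]
  apply le_min
  · rw [le_div_iff₀ hba]; linarith
  · rw [le_div_iff₀ hdc]; linarith

lemma tent_rise (a b c d : ℝ) (hab : a < b) (hbc : b ≤ c) (hcd : c < d) (x : E2)
    (h1 : Real.exp a ≤ ‖x‖) (h2 : ‖x‖ ≤ Real.exp b) :
    tent a b c d x = (b - a)⁻¹ * (Real.log ‖x‖ - a) := by
  have hba : 0 < b - a := by linarith
  have hdc : 0 < d - c := by linarith
  have h0 : 0 < ‖x‖ := (Real.exp_pos a).trans_le h1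
  have h3 : a ≤ Real.log ‖x‖ := (Real.le_log_iff_exp_le h0).2 h1
  have h4 : Real.log ‖x‖ ≤ b := (Real.log_le_iff_le_exp h0).2 h2
  have h5 : (Real.log ‖x‖ - a) / (b - a) ≤ 1 := by rw [div_le_one hba]; linarith
  have h6 : 1 ≤ (d - Real.log ‖x‖) / (d - c) := by rw [le_div_iff₀ hdc]; linarith
  have h7 : 0 ≤ (Real.log ‖x‖ - a) / (b - a) := div_nonneg (by linarith) hba.le
  unfold tent
  rw [logmax h1, min_eq_left (h5.trans h6), min_eq_right h5, max_eq_right h7]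
  ring

lemma tent_fall (a b c d : ℝ) (hab : a < b) (hbc : b ≤ c) (hcd : c < d) (x : E2)
    (h1 : Real.exp c ≤ ‖x‖) (h2 : ‖x‖ ≤ Real.exp d) :
    tent a b c d x = (-(d - c)⁻¹) * (Real.log ‖x‖ - d) := by
  have hba : 0 < b - a := by linarith
  have hdc : 0 < d - c := by linarith
  have h0 : 0 < ‖x‖ := (Real.exp_pos c).trans_le h1
  have h3 : c ≤ Real.log ‖x‖ := (Real.le_log_iff_exp_le h0).2 h1
  have h4 : Real.log ‖x‖ ≤ d := (Real.log_le_iff_le_exp h0).2 h2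
  have h5 : (d - Real.log ‖x‖) / (d - c) ≤ 1 := by rw [div_le_one hdc]; linarith
  have h6 : 1 ≤ (Real.log ‖x‖ - a) / (b - a) := by rw [le_div_iff₀ hba]; linarith
  have h7 : 0 ≤ (d - Real.log ‖x‖) / (d - c) := div_nonneg (by linarith) hdc.le
  unfold tent
  rw [logmax ((Real.exp_le_exp.2 (by linarith)).trans h1), min_eq_right (h5.trans h6),
    min_eq_right h5, max_eq_right h7]
  ring

lemma fderiv_log (s e : ℝ) (x : E2) (hx : x ≠ 0) :
    ‖fderiv ℝ (fun y : E2 => s * (Real.log ‖y‖ - e)) x‖ ^ 2 ≤ (s * ‖x‖⁻¹) ^ 2 := by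
  have hn : HasFDerivAt (fun y : E2 => ‖y‖) (fderiv ℝ (fun y : E2 => ‖y‖) x) x :=
    (DifferentiableAt.norm ℝ differentiableAt_id hx).hasFDerivAt
  have h1 : ‖fderiv ℝ (fun y : E2 => ‖y‖) x‖ ≤ 1 :=
    NNReal.coe_one ▸ norm_fderiv_le_of_lipschitz ℝ lipschitzWith_one_norm
  have h2 : HasFDerivAt (fun y : E2 => s * (Real.log ‖y‖ - e)) _ x :=
    ((hn.log (norm_ne_zero_iff.2 hx)).sub_const e).const_mul s
  rw [h2.fderiv, norm_smul, norm_smul, ← sq_abs (s * ‖x‖⁻¹), abs_mul]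
  simp only [Real.norm_eq_abs]
  gcongr
  exact mul_le_of_le_one_right (abs_nonneg _) h1

lemma tent_energy (a b c d : ℝ) (hab : a < b) (hbc : b ≤ c) (hcd : c < d) :
    ∫⁻ x : E2, ENNReal.ofReal (‖fderiv ℝ (tent a b c d) x‖ ^ 2) ≤
      ENNReal.ofReal (2 * Real.pi * ((b - a)⁻¹ + (d - c)⁻¹)) := by
  have hba : 0 < b - a := by linarith
  have hdc : 0 < d - c := by linarith
  have hs : ∀ r : ℝ, ∀ᵐ x : E2, ‖x‖ ≠ r := by
    intro r
    have := Measure.addHaar_sphere (volume : Measure E2) 0 r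
    rw [measure_eq_zero_iff_ae_notMem] at this
    filter_upwards [this] with x hx h
    exact hx (by simpa using h)
  calc _ ≤ ∫⁻ x : E2, (ENNReal.ofReal ((Set.Ioc (Real.exp a) (Real.exp b)).indicator
      (fun r => ((b - a)⁻¹ * r⁻¹) ^ 2) ‖x‖) +
        ENNReal.ofReal ((Set.Ioc (Real.exp c) (Real.exp d)).indicator
      (fun r => (-(d - c)⁻¹ * r⁻¹) ^ 2) ‖x‖)) := by
        apply lintegral_mono_ae
        filter_upwards [hs (Real.exp a), hs (Real.exp b), hs (Real.exp c), hs (Real.exp d)]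
          with x xa xb xc xd
        have hopen : ∀ u v : ℝ, u < ‖x‖ → ‖x‖ < v → ∀ᶠ y in nhds x, u < ‖y‖ ∧ ‖y‖ < v :=
          fun u v h1 h2 => (continuous_norm.continuousAt.eventually_const_lt h1).and
            (continuous_norm.continuousAt.eventually_lt_const h2)
        have zero_of : ∀ k : ℝ, (tent a b c d =ᶠ[nhds x] fun _ => k) →
          ENNReal.ofReal (‖fderiv ℝ (tent a b c d) x‖ ^ 2) = 0 := by
          intro k hk; rw [hk.fderiv_eq]; simp
        rcases lt_or_gt_of_ne xa with ha | ha
        · rw [zero_of 0]; · exact zero_le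
          filter_upwards [hopen (-1) _ (by linarith [norm_nonneg x]) ha] with y hy
          by_contra h
          exact absurd (tent_supp a b c d hab hcd (by linarith) y h).1 (by linarith [hy.2])
        rcases lt_or_gt_of_ne xb with hb | hb
        · refine le_trans ?_ le_self_add
          rw [Set.indicator_of_mem (Set.mem_Ioc.2 ⟨ha, hb.le⟩)]
          apply ENNReal.ofReal_le_ofReal
          have : tent a b c d =ᶠ[nhds x] fun y => (b - a)⁻¹ * (Real.log ‖y‖ - a) := by
            filter_upwards [hopen _ _ ha hb] with y hy
            exact tent_rise a b c d hab hbc hcd y hy.1.le hy.2.le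
          rw [this.fderiv_eq]
          exact fderiv_log _ _ x (norm_pos_iff.1 ((Real.exp_pos a).trans ha))
        rcases lt_or_gt_of_ne xc with hc | hc
        · rw [zero_of 1]; · exact zero_le
          filter_upwards [hopen _ _ hb hc] with y hy
          exact tent_one a b c d hab hcd y hy.1.le hy.2.le
        rcases lt_or_gt_of_ne xd with hd | hd
        · refine le_trans ?_ le_add_self
          rw [Set.indicator_of_mem (Set.mem_Ioc.2 ⟨hc, hd.le⟩)]
          apply ENNReal.ofReal_le_ofReal
          have : tent a b c d =ᶠ[nhds x] fun y => -(d - c)⁻¹ * (Real.log ‖y‖ - d) := by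
            filter_upwards [hopen _ _ hc hd] with y hy
            exact tent_fall a b c d hab hbc hcd y hy.1.le hy.2.le
          rw [this.fderiv_eq]
          exact fderiv_log _ _ x (norm_pos_iff.1 ((Real.exp_pos c).trans hc))
        · rw [zero_of 0]; · exact zero_le
          filter_upwards [hopen _ (‖x‖ + 1) hd (by linarith)] with y hy
          by_contra h
          exact absurd (tent_supp a b c d hab hcd (by linarith) y h).2 (by linarith [hy.1])
    _ = _ := by
        rw [lintegral_add_left]
        · rw [ann_energy _ _ _ hab, ann_energy _ _ _ hcd, ← ENNReal.ofReal_add]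
          · congr 1; field_simp
          · positivity
          · positivity
        · have hm : Measurable ((Set.Ioc (Real.exp a) (Real.exp b)).indicator
              (fun r : ℝ => ((b - a)⁻¹ * r⁻¹) ^ 2)) :=
            Measurable.indicator (by fun_prop) measurableSet_Ioc
          exact ENNReal.measurable_ofReal.comp (hm.comp measurable_norm)

noncomputable def apt (n : ℤ) : ℝ := if 0 < n then (2 : ℝ) ^ (n - 1) else -(2 : ℝ) ^ (-n)

lemma apt_pos {n : ℤ} (h : 0 < n) : apt n = (2 : ℝ) ^ (n - 1) := by simp [apt, h]
lemma apt_neg {n : ℤ} (h : n ≤ 0) : apt n = -(2 : ℝ) ^ (-n) := by simp [apt, not_lt.2 h]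

lemma apt_mono : StrictMono apt := by
  apply strictMono_int_of_lt_succ
  intro n
  rcases lt_trichotomy n 0 with h | h | h
  · rw [apt_neg h.le, apt_neg (by omega)]
    have : (2 : ℝ) ^ (-(n + 1)) < 2 ^ (-n) := zpow_lt_zpow_right₀ (by norm_num) (by omega)
    linarith
  · subst h; norm_num [apt]
  · rw [apt_pos h, apt_pos (by omega)]
    exact zpow_lt_zpow_right₀ (by norm_num) (by omega)

lemma annU_eq (n : ℤ) : annU n = {x | Real.exp (apt n) < ‖x‖ ∧ ‖x‖ < Real.exp (apt (n + 1))} := by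
  unfold annU
  rcases lt_trichotomy n 0 with h | h | h
  · rw [if_neg (by omega), if_pos h, apt_neg h.le, apt_neg (by omega), neg_add']
  · subst h; norm_num [apt]
  · rw [if_pos h, apt_pos h, apt_pos (by omega), add_sub_cancel_right]

lemma apt_energy (n : ℤ) :
    (apt n - apt (n - 1))⁻¹ + (apt (n + 2) - apt (n + 1))⁻¹ ≤ 5 / (2 : ℝ) ^ |n| := by
  have two : (2 : ℝ) ≠ 0 := two_ne_zero
  have hq : ∀ k : ℤ, (2 : ℝ) ^ (k + 1) = 2 * 2 ^ k := fun k => by rw [zpow_add_one₀ two]; ring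
  rcases lt_trichotomy n 0 with h | h | h
  · rcases eq_or_ne n (-1) with h1 | h1
    · subst h1; norm_num [apt]
    · obtain ⟨m, rfl⟩ : ∃ m : ℤ, n = -(m + 2) := ⟨-n - 2, by ring⟩
      have hm : 0 ≤ m := by omega
      rw [apt_neg h.le, apt_neg (by omega), apt_neg (by omega), apt_neg (by omega), abs_of_neg h]
      have e1 : (2 : ℝ) ^ (- -(m + 2)) = 4 * 2 ^ m := by
        rw [show - -(m + 2) = m + 1 + 1 by ring, hq, hq]; ring
      have e2 : (2 : ℝ) ^ (-(-(m + 2) - 1)) = 8 * 2 ^ m := by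
        rw [show -(-(m + 2) - 1) = m + 1 + 1 + 1 by ring, hq, hq, hq]; ring
      have e3 : (2 : ℝ) ^ (-(-(m + 2) + 2)) = 2 ^ m := by
        rw [show -(-(m + 2) + 2) = m by ring]
      have e4 : (2 : ℝ) ^ (-(-(m + 2) + 1)) = 2 * 2 ^ m := by
        rw [show -(-(m + 2) + 1) = m + 1 by ring, hq]
      rw [e1, e2, e3, e4]
      have hp : (0 : ℝ) < 2 ^ m := by positivity
      generalize (2 : ℝ) ^ m = p at hp
      rw [show -(4 * p) - -(8 * p) = 4 * p by ring, show -p - -(2 * p) = p by ring]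
      apply le_of_eq; field_simp; norm_num
  · subst h; norm_num [apt]
  · rcases eq_or_ne n 1 with h1 | h1
    · subst h1; norm_num [apt]
    · obtain ⟨m, rfl⟩ : ∃ m : ℤ, n = m + 2 := ⟨n - 2, by ring⟩
      have hm : 0 ≤ m := by omega
      rw [apt_pos h, apt_pos (by omega), apt_pos (by omega), apt_pos (by omega), abs_of_pos h]
      have e1 : (2 : ℝ) ^ (m + 2 - 1) = 2 * 2 ^ m := by
        rw [show m + 2 - 1 = m + 1 by ring, hq]
      have e2 : (2 : ℝ) ^ (m + 2 - 1 - 1) = 2 ^ m := by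
        rw [show m + 2 - 1 - 1 = m by ring]
      have e3 : (2 : ℝ) ^ (m + 2 + 2 - 1) = 8 * 2 ^ m := by
        rw [show m + 2 + 2 - 1 = m + 1 + 1 + 1 by ring, hq, hq, hq]; ring
      have e4 : (2 : ℝ) ^ (m + 2 + 1 - 1) = 4 * 2 ^ m := by
        rw [show m + 2 + 1 - 1 = m + 1 + 1 by ring, hq, hq]; ring
      have e5 : (2 : ℝ) ^ (m + 2) = 4 * 2 ^ m := by
        rw [show m + 2 = m + 1 + 1 by ring, hq, hq]; ring
      rw [e1, e2, e3, e4, e5]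
      have hp : (0 : ℝ) < 2 ^ m := by positivity
      generalize (2 : ℝ) ^ m = p at hp
      rw [show 2 * p - p = p by ring, show 8 * p - 4 * p = 4 * p by ring]
      apply le_of_eq; field_simp; norm_num

lemma annU_log {n : ℤ} (hn : n ≠ 0) {x : E2} (hx : x ∈ annU n) :
    |Real.log ‖x‖| < (2 : ℝ) ^ |n| := by
  rw [annU_eq] at hx
  obtain ⟨h1, h2⟩ := hx
  have h0 : 0 < ‖x‖ := (Real.exp_pos _).trans h1
  rw [← Real.lt_log_iff_exp_lt h0] at h1
  rw [← Real.log_lt_iff_lt_exp h0] at h2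
  rcases lt_or_gt_of_ne hn with h | h
  · rw [apt_neg h.le] at h1
    rw [apt_neg (by omega)] at h2
    have : (0 : ℝ) < 2 ^ (-(n + 1)) := by positivity
    rw [abs_of_neg h, abs_of_neg (by linarith)]; linarith
  · rw [apt_pos h] at h1
    rw [apt_pos (by omega), add_sub_cancel_right] at h2
    have : (0 : ℝ) < 2 ^ (n - 1) := by positivity
    rw [abs_of_pos h, abs_of_pos (by linarith)]; linarith

lemma annU_meas (n : ℤ) : MeasurableSet (annU n) := by
  rw [annU_eq]
  exact (measurableSet_lt measurable_const measurable_norm).inter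
    (measurableSet_lt measurable_norm measurable_const)

lemma annU_lower (V : E2 → ℝ) (hV0 : ∀ x, 0 ≤ V x) (hV : LocallyIntegrable V volume) (n : ℤ)
    (h : ENNReal.ofReal (10 * Real.pi) ≤ annA V n) :
    ENNReal.ofReal (2 * Real.pi * ((apt n - apt (n - 1))⁻¹ + (apt (n + 2) - apt (n + 1))⁻¹)) <
      ∫⁻ x in annU n, ENNReal.ofReal (V x) := by
  have hpi := Real.pi_pos
  rcases eq_or_ne n 0 with rfl | hn
  · rw [annA, if_pos rfl] at h
    refine lt_of_lt_of_le ?_ h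
    rw [ENNReal.ofReal_lt_ofReal_iff (by positivity)]
    norm_num [apt]
    linarith
  rw [annA, if_neg hn] at h
  have hp : (0 : ℝ) < 2 ^ |n| := by positivity
  have hlog := fun x (hx : x ∈ annU n) => annU_log hn hx
  have hen := apt_energy n
  generalize (2 : ℝ) ^ |n| = p at hp hlog hen
  have hVm : AEMeasurable V (volume.restrict (annU n)) :=
    hV.aestronglyMeasurable.aemeasurable.restrict
  have hI : ∫⁻ x in annU n, ENNReal.ofReal (V x) ≠ ∞ := by
    have hi : IntegrableOn V (annU n) := by
      refine (hV.integrableOn_isCompact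
        (isCompact_closedBall (0 : E2) (Real.exp (apt (n + 1))))).mono_set ?_
      intro x hx
      rw [annU_eq] at hx
      simpa using hx.2.le
    exact ((hasFiniteIntegral_iff_ofReal (Filter.Eventually.of_forall hV0)).1 hi.2).ne
  have hpI : ∫⁻ x in annU n, ENNReal.ofReal (V x * p) =
      ENNReal.ofReal p * ∫⁻ x in annU n, ENNReal.ofReal (V x) := by
    rw [← lintegral_const_mul' _ _ ENNReal.ofReal_ne_top]
    congr 1; ext x; rw [← ENNReal.ofReal_mul hp.le, mul_comm]
  have hle : (fun x => ENNReal.ofReal (V x * |Real.log ‖x‖|)) ≤ᵐ[volume.restrict (annU n)]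
      fun x => ENNReal.ofReal (V x * p) := by
    filter_upwards [ae_restrict_mem (annU_meas n)] with x hx
    exact ENNReal.ofReal_le_ofReal (mul_le_mul_of_nonneg_left (hlog x hx).le (hV0 x))
  have hlt : ∫⁻ x in annU n, ENNReal.ofReal (V x * |Real.log ‖x‖|) <
      ∫⁻ x in annU n, ENNReal.ofReal (V x * p) := by
    apply lintegral_strict_mono_of_ae_le_of_frequently_ae_lt
    · exact (hVm.mul_const p).ennreal_ofReal
    · refine ne_top_of_le_ne_top ?_ (lintegral_mono_ae hle)
      rw [hpI]; exact ENNReal.mul_ne_top ENNReal.ofReal_ne_top hI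
    · exact hle
    · by_contra hcon
      rw [Filter.not_frequently] at hcon
      have hz : ∫⁻ x in annU n, ENNReal.ofReal (V x * |Real.log ‖x‖|) = 0 := by
        rw [← lintegral_zero (μ := volume.restrict (annU n))]
        apply lintegral_congr_ae
        filter_upwards [hcon, ae_restrict_mem (annU_meas n)] with x hx hxU
        rw [not_not] at hx
        rcases (hV0 x).eq_or_lt with h0 | h0
        · simp [← h0]
        · exfalso
          have : ENNReal.ofReal (V x * |Real.log ‖x‖|) < ENNReal.ofReal (V x * p) :=
            (ENNReal.ofReal_lt_ofReal_iff (by positivity)).2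
              (mul_lt_mul_of_pos_left (hlog x hxU) h0)
          exact this.ne hx
      rw [hz] at h
      have : (0 : ℝ≥0∞) < ENNReal.ofReal (10 * Real.pi) := ENNReal.ofReal_pos.2 (by positivity)
      exact absurd h (not_le.2 this)
  rw [hpI] at hlt
  refine lt_of_mul_lt_mul_left' (a := ENNReal.ofReal p) (lt_of_le_of_lt ?_ (h.trans_lt hlt))
  rw [← ENNReal.ofReal_mul hp.le]
  apply ENNReal.ofReal_le_ofReal
  calc _ ≤ p * (2 * Real.pi * (5 / p)) := by gcongr
    _ = 10 * Real.pi := by field_simp; norm_num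

noncomputable def ww (n : ℤ) : E2 → ℝ := tent (apt (n - 1)) (apt n) (apt (n + 1)) (apt (n + 2))

lemma ww_energy (V : E2 → ℝ) (hV0 : ∀ x, 0 ≤ V x) (hV : LocallyIntegrable V volume) (n : ℤ)
    (h : ENNReal.ofReal (10 * Real.pi) ≤ annA V n) :
    (∫⁻ x in {x | DifferentiableAt ℝ (ww n) x}, ENNReal.ofReal (‖fderiv ℝ (ww n) x‖ ^ 2)) <
            ∫⁻ x, ENNReal.ofReal (V x * ww n x ^ 2) := by
  have l1 : apt (n - 1) < apt n := apt_mono (by omega)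
  have l2 : apt n < apt (n + 1) := apt_mono (by omega)
  have l3 : apt (n + 1) < apt (n + 2) := apt_mono (by omega)
  refine (setLIntegral_le_lintegral _ _).trans_lt ?_
  refine (tent_energy _ _ _ _ l1 l2.le l3).trans_lt ?_
  refine (annU_lower V hV0 hV n h).trans_le ?_
  refine le_trans (le_of_eq ?_) (setLIntegral_le_lintegral (annU n) _)
  apply setLIntegral_congr_fun (annU_meas n)
  intro x hx
  rw [annU_eq] at hx
  simp [ww, tent_one _ _ _ _ l1 l3 x hx.1.le hx.2.le]

lemma ww_supp (n : ℤ) (x : E2) (h : ww n x ≠ 0) :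
    Real.exp (apt (n - 1)) < ‖x‖ ∧ ‖x‖ < Real.exp (apt (n + 2)) :=
  tent_supp _ _ _ _ (apt_mono (by omega)) (apt_mono (by omega)) (apt_mono (by omega)) x h

lemma ww_disj (m n : ℤ) (h : m + 3 ≤ n) :
    Disjoint (Function.support (ww m)) (Function.support (ww n)) := by
  rw [Set.disjoint_left]
  intro x h1 h2
  have h3 := (ww_supp m x h1).2
  have h4 := (ww_supp n x h2).1
  have h5 : apt (m + 2) ≤ apt (n - 1) := apt_mono.monotone (by omega)
  have := Real.exp_le_exp.2 h5
  linarith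

/-- Theorem `logneces` in variational form: if `card{n ∈ ℤ : A_n ≥ 10π} ≥ 3N`, then there
exist `N` Lipschitz, compactly supported, nontrivial functions `w₁,…,w_N` with pairwise
disjoint supports on each of which the Schrödinger form is negative:
`∫ |∇w_j|² dx < ∫ V·w_j² dx`. -/
theorem negative_subspace_of_card (V : EuclideanSpace ℝ (Fin 2) → ℝ)
    (hV0 : ∀ x, 0 ≤ V x) (hV : LocallyIntegrable V volume) (N : ℕ)
    (hcard : (3 * N : ℕ∞) ≤ {n : ℤ | ENNReal.ofReal (10 * Real.pi) ≤ annA V n}.encard) :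
    ∃ w : Fin N → EuclideanSpace ℝ (Fin 2) → ℝ,
      (∀ j, ∃ K : NNReal, LipschitzWith K (w j)) ∧
      (∀ j, HasCompactSupport (w j)) ∧
      (∀ j, w j ≠ 0) ∧
      (Pairwise fun i j => Disjoint (Function.support (w i)) (Function.support (w j))) ∧
      ∀ j, (∫⁻ x in {x | DifferentiableAt ℝ (w j) x},
              ENNReal.ofReal (‖fderiv ℝ (w j) x‖ ^ 2)) <
            ∫⁻ x, ENNReal.ofReal (V x * w j x ^ 2) := by
  classical
  obtain ⟨T, hTS, hT⟩ := Set.exists_subset_encard_eq hcard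
  have hTf : T.Finite := by
    rw [← Set.encard_ne_top_iff, hT]
    exact_mod_cast ENat.coe_ne_top (3 * N)
  lift T to Finset ℤ using hTf
  have hTc : T.card = 3 * N := by
    rw [Set.encard_coe_eq_coe_finsetCard] at hT
    exact_mod_cast hT
  obtain ⟨r, hr, hcr⟩ := Finset.exists_le_card_fiber_of_mul_le_card_of_maps_to
    (s := T) (t := Finset.Ico (0 : ℤ) 3) (f := fun n => n % 3) (n := N)
    (fun n _ => by simp only [Finset.mem_Ico]; omega) ⟨0, by simp⟩ (by simp [hTc])
  obtain ⟨Q, hQ, hQc⟩ := Finset.exists_subset_card_eq hcr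
  let e : Fin N ≃ Q := (Fin.castOrderIso hQc.symm).toEquiv.trans Q.equivFin.symm
  have hmem : ∀ j, (e j : ℤ) ∈ T ∧ (e j : ℤ) % 3 = r := fun j => by
    have := hQ (e j).2
    rwa [Finset.mem_filter] at this
  have hen := fun j => ww_energy V hV0 hV (e j) (hTS (hmem j).1)
  refine ⟨fun j => ww (e j), fun j => ?_, fun j => ?_, fun j hj => ?_, fun i j hij => ?_, hen⟩
  · exact tent_lip _ _ _ _ (apt_mono (by omega)) (apt_mono (by omega))
  · refine HasCompactSupport.of_support_subset_isCompact
      (isCompact_closedBall (0 : E2) (Real.exp (apt (e j + 2)))) ?_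
    intro x hx
    simpa using (ww_supp _ x hx).2.le
  · have := hen j
    dsimp only at hj
    rw [hj] at this
    simp at this
  · have hne : (e i : ℤ) ≠ e j := fun h => hij (e.injective (Subtype.ext h))
    have h1 := (hmem i).2
    have h2 := (hmem j).2
    rcases lt_or_gt_of_ne hne with h | h
    · exact ww_disj _ _ (by omega)
    · exact (ww_disj _ _ (by omega)).symm
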